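/- Suppose z₀ ∈ S satisfies ∇F(z₀) = E[∇F(X)]. Then for every z in S, E[D_F(z, X)] = E[D_F(z₀, X)] + D_F(z, z₀). Consequently, z₀ is the unique minimizer over S of the map z ↦ E[D_F(z, X)]. -/

import Mathlib

open MeasureTheory
open scoped RealInnerProductSpace

/-- The Bregman divergence `D_F(y, x) = F y - F x - ⟪∇F x, y - x⟫`. -/
noncomputable def bregmanDiv {E : Type*} [NormedAddCommGroup E] [InnerProductSpace ℝ E]
    (F : E → ℝ) (f' : E → E) (y x : E) : ℝ :=
  F y - F x - ⟪f' x, y - x⟫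

/-- A function which is strictly convex on `S` lies strictly above its tangent hyperplane at any
point of `S` where it is differentiable. -/
theorem StrictConvexOn.bregmanDiv_pos
    {E : Type*} [NormedAddCommGroup E] [InnerProductSpace ℝ E] [CompleteSpace E]
    {S : Set E} {F : E → ℝ} {f' : E → E} (hF : StrictConvexOn ℝ S F) {x y : E}
    (hx : x ∈ S) (hy : y ∈ S) (hyx : y ≠ x) (hdiff : HasGradientAt F (f' x) x) :
    0 < bregmanDiv F f' y x := by
  have hline : StrictConvexOn ℝ (Set.Icc (0 : ℝ) 1) (F ∘ AffineMap.lineMap x y) := by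
    refine ⟨convex_Icc 0 1, fun s hs t ht hst a b ha hb hab => ?_⟩
    have hmem : ∀ r ∈ Set.Icc (0 : ℝ) 1, AffineMap.lineMap x y r ∈ S :=
      fun r hr => hF.1.lineMap_mem hx hy hr
    have hne : AffineMap.lineMap x y s ≠ AffineMap.lineMap x y t :=
      (AffineMap.lineMap_injective ℝ hyx.symm).ne hst
    have h := hF.2 (hmem s hs) (hmem t ht) hne ha hb hab
    rwa [← Convex.combo_affine_apply hab] at h
  have hderiv : HasDerivAt (F ∘ AffineMap.lineMap x y) ⟪f' x, y - x⟫ (0 : ℝ) := by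
    have hfd : HasFDerivAt F (InnerProductSpace.toDual ℝ E (f' x))
        (AffineMap.lineMap x y (0 : ℝ)) := by
      simpa using hdiff.hasFDerivAt
    simpa using hfd.comp_hasDerivAt (0 : ℝ) AffineMap.hasDerivAt_lineMap
  have h := hline.lt_slope_of_hasDerivAt (by simp) (by simp) one_pos hderiv
  simp only [slope_def_field, Function.comp_apply, AffineMap.lineMap_apply_one,
    AffineMap.lineMap_apply_zero, sub_zero, div_one] at h
  exact sub_pos.2 h

/-- The expected Bregman divergence from a fixed point to a random variable, in terms of the
expectation of the gradient. -/
theorem integral_bregmanDiv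
    {E : Type*} [NormedAddCommGroup E] [InnerProductSpace ℝ E] [CompleteSpace E]
    {Ω : Type*} [MeasurableSpace Ω] {μ : Measure Ω} [IsProbabilityMeasure μ]
    {F : E → ℝ} {f' : E → E} {X : Ω → E}
    (hFX : Integrable (fun ω => F (X ω)) μ)
    (hf'X : Integrable (fun ω => f' (X ω)) μ)
    (hinner : Integrable (fun ω => ⟪f' (X ω), X ω⟫) μ) (z : E) :
    ∫ ω, bregmanDiv F f' z (X ω) ∂μ
      = F z - (∫ ω, F (X ω) ∂μ) - (⟪∫ ω, f' (X ω) ∂μ, z⟫ - ∫ ω, ⟪f' (X ω), X ω⟫ ∂μ) := by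
  have hz : Integrable (fun ω => ⟪f' (X ω), z⟫) μ := hf'X.inner_const z
  have hmean : ∫ ω, ⟪f' (X ω), z⟫ ∂μ = ⟪∫ ω, f' (X ω) ∂μ, z⟫ := by
    simp_rw [real_inner_comm z]
    exact integral_inner hf'X z
  have hFz : Integrable (fun ω => F z - F (X ω)) μ := (integrable_const _).sub hFX
  have hgrad : Integrable (fun ω => ⟪f' (X ω), z⟫ - ⟪f' (X ω), X ω⟫) μ := hz.sub hinner
  simp only [bregmanDiv, inner_sub_right]
  rw [integral_sub hFz hgrad, integral_sub (integrable_const _) hFX, integral_sub hz hinner, hmean]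
  simp

/-- if `z₀ ∈ S` satisfies `∇F(z₀) = E[∇F(X)]` then for every `z ∈ S`,
`E[D_F(z, X)] = E[D_F(z₀, X)] + D_F(z, z₀)`; consequently `z₀` is the unique
minimizer over `S` of `z ↦ E[D_F(z, X)]`. -/
theorem dual_mean_minimizes_expected_divergence_to
    {E : Type*} [NormedAddCommGroup E] [InnerProductSpace ℝ E] [CompleteSpace E]
    {Ω : Type*} [MeasurableSpace Ω] (μ : Measure Ω) [IsProbabilityMeasure μ]
    (S : Set E) (hS : Convex ℝ S) (F : E → ℝ) (f' : E → E)
    (hF : StrictConvexOn ℝ S F) (hdiff : ∀ x ∈ S, HasGradientAt F (f' x) x)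
    (X : Ω → E) (hXS : ∀ ω, X ω ∈ S)
    (hXint : Integrable X μ)
    (hFX : Integrable (fun ω => F (X ω)) μ)
    (hf'X : Integrable (fun ω => f' (X ω)) μ)
    (hinner : Integrable (fun ω => ⟪f' (X ω), X ω⟫) μ)
    (z₀ : E) (hz₀S : z₀ ∈ S) (hz₀ : f' z₀ = ∫ ω, f' (X ω) ∂μ) :
    (∀ z ∈ S,
      ∫ ω, bregmanDiv F f' z (X ω) ∂μ
        = (∫ ω, bregmanDiv F f' z₀ (X ω) ∂μ) + bregmanDiv F f' z z₀) ∧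
    (∀ z ∈ S, z ≠ z₀ →
      (∫ ω, bregmanDiv F f' z₀ (X ω) ∂μ) < ∫ ω, bregmanDiv F f' z (X ω) ∂μ) := by
  have hid : ∀ z : E, ∫ ω, bregmanDiv F f' z (X ω) ∂μ
      = (∫ ω, bregmanDiv F f' z₀ (X ω) ∂μ) + bregmanDiv F f' z z₀ := by
    intro z
    rw [integral_bregmanDiv hFX hf'X hinner, integral_bregmanDiv hFX hf'X hinner, ← hz₀,
      bregmanDiv, inner_sub_right]
    ring
  refine ⟨fun z _ => hid z, fun z hz hne => ?_⟩
  rw [hid z]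
  exact lt_add_of_pos_right _ (hF.bregmanDiv_pos hz₀S hz hne (hdiff z₀ hz₀S))
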